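/- For any positive integer u and any integer n ≥ 9u - 3, one has A(4u, 6u, n) = u (i.e., the lower bound g/4 with g = 4u is attained). -/

import Mathlib

open SimpleGraph Set

/-- Auxiliary distance on representations of points of the metric graph:
a point is represented by `(u, v, t)` with `u, v` adjacent and `t ∈ [0,1]`,
meaning the point on the edge `[u,v]` at distance `t` from `u`. -/
noncomputable def mgDistAux {V : Type} [Fintype V] [DecidableEq V] (G : SimpleGraph V)
    (p q : V × V × ℝ) : ℝ :=
  min
    (min (if p.1 = q.1 ∧ p.2.1 = q.2.1 then |p.2.2 - q.2.2| else (Fintype.card V : ℝ) + 1)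
         (if p.1 = q.2.1 ∧ p.2.1 = q.1 then |p.2.2 - (1 - q.2.2)| else (Fintype.card V : ℝ) + 1))
    (min (min (p.2.2 + (G.dist p.1 q.1 : ℝ) + q.2.2)
              (p.2.2 + (G.dist p.1 q.2.1 : ℝ) + (1 - q.2.2)))
         (min ((1 - p.2.2) + (G.dist p.2.1 q.1 : ℝ) + q.2.2)
              ((1 - p.2.2) + (G.dist p.2.1 q.2.1 : ℝ) + (1 - q.2.2))))

/-- The points of the metric graph associated to a simple graph `G`:
the vertices together with the interior points of the edges. -/
def MGPoint {V : Type} (G : SimpleGraph V) : Type :=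
  {p : V × V × ℝ // G.Adj p.1 p.2.1 ∧ p.2.2 ∈ Set.Icc (0 : ℝ) 1}

/-- The shortest-path distance on the metric graph associated to `G`
(every edge has length 1). -/
noncomputable def mgDist {V : Type} [Fintype V] [DecidableEq V] (G : SimpleGraph V)
    (p q : MGPoint G) : ℝ := mgDistAux G p.1 q.1

/-- Distance from a vertex `v` to a point of the metric graph. -/
noncomputable def mgVDist {V : Type} [Fintype V] [DecidableEq V] (G : SimpleGraph V)
    (v : V) (x : MGPoint G) : ℝ :=
  min ((G.dist v x.1.1 : ℝ) + x.1.2.2) ((G.dist v x.1.2.1 : ℝ) + (1 - x.1.2.2))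

/-- `γ` restricted to `[a,b]` is a geodesic in the metric graph of `G`
(an arc-length parametrization realizing distances). -/
def IsMGGeodesic {V : Type} [Fintype V] [DecidableEq V] (G : SimpleGraph V)
    (a b : ℝ) (γ : ℝ → MGPoint G) : Prop :=
  a ≤ b ∧ ∀ s ∈ Set.Icc a b, ∀ t ∈ Set.Icc a b, mgDist G (γ s) (γ t) = |s - t|

/-- A geodesic triangle in the metric graph of `G`: three geodesic sides whose
endpoints match cyclically (distance `0` means equality of points). -/
structure MGTriangle {V : Type} [Fintype V] [DecidableEq V] (G : SimpleGraph V) where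
  a1 : ℝ
  b1 : ℝ
  a2 : ℝ
  b2 : ℝ
  a3 : ℝ
  b3 : ℝ
  g1 : ℝ → MGPoint G
  g2 : ℝ → MGPoint G
  g3 : ℝ → MGPoint G
  h1 : IsMGGeodesic G a1 b1 g1
  h2 : IsMGGeodesic G a2 b2 g2
  h3 : IsMGGeodesic G a3 b3 g3
  glue1 : mgDist G (g1 b1) (g2 a2) = 0
  glue2 : mgDist G (g2 b2) (g3 a3) = 0
  glue3 : mgDist G (g3 b3) (g1 a1) = 0

/-- The sharp thin constant `δ(T)` of a geodesic triangle: the infimum of the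
`d ≥ 0` such that each side is contained in the `d`-neighborhood of the union of
the other two sides. -/
noncomputable def triangleDelta {V : Type} [Fintype V] [DecidableEq V] {G : SimpleGraph V}
    (T : MGTriangle G) : ℝ :=
  sInf {d : ℝ | 0 ≤ d ∧
    (∀ s ∈ Set.Icc T.a1 T.b1,
      (∃ t ∈ Set.Icc T.a2 T.b2, mgDist G (T.g1 s) (T.g2 t) ≤ d) ∨
      (∃ t ∈ Set.Icc T.a3 T.b3, mgDist G (T.g1 s) (T.g3 t) ≤ d)) ∧
    (∀ s ∈ Set.Icc T.a2 T.b2,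
      (∃ t ∈ Set.Icc T.a1 T.b1, mgDist G (T.g2 s) (T.g1 t) ≤ d) ∨
      (∃ t ∈ Set.Icc T.a3 T.b3, mgDist G (T.g2 s) (T.g3 t) ≤ d)) ∧
    (∀ s ∈ Set.Icc T.a3 T.b3,
      (∃ t ∈ Set.Icc T.a1 T.b1, mgDist G (T.g3 s) (T.g1 t) ≤ d) ∨
      (∃ t ∈ Set.Icc T.a2 T.b2, mgDist G (T.g3 s) (T.g2 t) ≤ d))}

/-- The hyperbolicity constant `δ(G)`: the supremum of `δ(T)` over all geodesic
triangles `T` in the metric graph of `G`. -/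
noncomputable def hypDelta {V : Type} [Fintype V] [DecidableEq V] (G : SimpleGraph V) : ℝ :=
  sSup {d : ℝ | ∃ T : MGTriangle G, d = triangleDelta T}

/-- The circumference of `G`: the length of a longest cycle. -/
noncomputable def circumference {V : Type} (G : SimpleGraph V) : ℕ :=
  sSup {n : ℕ | ∃ (a : V) (w : G.Walk a a), w.IsCycle ∧ w.length = n}

/-- `G` belongs to the class `𝒢(g,c,n)` of (connected) graphs with girth `g`,
circumference `c` and `n` vertices (vertex set `Fin n`). -/
def memGclass (g c : ℕ) {n : ℕ} (G : SimpleGraph (Fin n)) : Prop :=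
  G.Connected ∧ G.girth = g ∧ circumference G = c

/-- `A(g,c,n) = min {δ(G) : G ∈ 𝒢(g,c,n)}`. -/
noncomputable def Agcn (g c n : ℕ) : ℝ :=
  sInf {d : ℝ | ∃ G : SimpleGraph (Fin n), memGclass g c G ∧ d = hypDelta G}

/-- `B(g,c,n) = max {δ(G) : G ∈ 𝒢(g,c,n)}`. -/
noncomputable def Bgcn (g c n : ℕ) : ℝ :=
  sSup {d : ℝ | ∃ G : SimpleGraph (Fin n), memGclass g c G ∧ d = hypDelta G}

/-- `G` belongs to the class `ℋ(g,c,m)` of (connected) graphs with girth `g`,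
circumference `c` and `m` edges. -/
def memHclass (g c m : ℕ) {k : ℕ} (G : SimpleGraph (Fin k)) : Prop :=
  G.Connected ∧ G.girth = g ∧ circumference G = c ∧ G.edgeSet.ncard = m

/-- `α(g,c,m) = min {δ(G) : G ∈ ℋ(g,c,m)}`. -/
noncomputable def alphagcm (g c m : ℕ) : ℝ :=
  sInf {d : ℝ | ∃ (k : ℕ) (G : SimpleGraph (Fin k)), memHclass g c m G ∧ d = hypDelta G}

/-- `β(g,c,m) = max {δ(G) : G ∈ ℋ(g,c,m)}`. -/
noncomputable def betagcm (g c m : ℕ) : ℝ :=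
  sSup {d : ℝ | ∃ (k : ℕ) (G : SimpleGraph (Fin k)), memHclass g c m G ∧ d = hypDelta G}


set_option linter.unusedSectionVars false

section MetricLemmas

variable {V : Type} [Fintype V] [DecidableEq V] {G : SimpleGraph V}

lemma mgDist_comm (p q : MGPoint G) : mgDist G p q = mgDist G q p := by
  obtain ⟨⟨a, b, s⟩, hp, hs⟩ := p
  obtain ⟨⟨c, d, t⟩, hq, ht⟩ := q
  simp only [mgDist, mgDistAux]
  rw [G.dist_comm (u := c) (v := a), G.dist_comm (u := c) (v := b),
    G.dist_comm (u := d) (v := a), G.dist_comm (u := d) (v := b)]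
  have e1 : (if a = c ∧ b = d then |s - t| else (Fintype.card V : ℝ) + 1)
      = (if c = a ∧ d = b then |t - s| else (Fintype.card V : ℝ) + 1) := by
    rw [abs_sub_comm]; simp only [eq_comm]
  have e2 : (if a = d ∧ b = c then |s - (1 - t)| else (Fintype.card V : ℝ) + 1)
      = (if c = b ∧ d = a then |t - (1 - s)| else (Fintype.card V : ℝ) + 1) := by
    have : |s - (1 - t)| = |t - (1 - s)| := by congr 1; ring
    rw [this]
    split_ifs with h1 h2 h2
    · rfl
    · exact absurd ⟨h1.2.symm, h1.1.symm⟩ h2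
    · exact absurd ⟨h2.2.symm, h2.1.symm⟩ h1
    · rfl
  rw [e1, e2]
  congr 1
  rw [min_min_min_comm]
  congr 1
  · congr 1 <;> ring
  · congr 1 <;> ring

lemma mgDist_nonneg (p q : MGPoint G) : 0 ≤ mgDist G p q := by
  obtain ⟨⟨a, b, s⟩, hp, hs0, hs1⟩ := p
  obtain ⟨⟨c, d, t⟩, hq, ht0, ht1⟩ := q
  simp only [mgDist, mgDistAux]
  simp only at hs0 hs1 ht0 ht1
  have h1 : (0 : ℝ) ≤ 1 - s := by linarith
  have h2 : (0 : ℝ) ≤ 1 - t := by linarith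
  refine le_min (le_min ?_ ?_) (le_min (le_min ?_ ?_) (le_min ?_ ?_))
  · split_ifs <;> positivity
  · split_ifs <;> positivity
  all_goals positivity

lemma mgDist_le_card (p q : MGPoint G) : mgDist G p q ≤ (Fintype.card V : ℝ) + 1 := by
  obtain ⟨⟨a, b, s⟩, hp, hs0, hs1⟩ := p
  obtain ⟨⟨c, d, t⟩, hq, ht0, ht1⟩ := q
  simp only [mgDist, mgDistAux]
  simp only at hs0 hs1 ht0 ht1
  refine (min_le_left _ _).trans ((min_le_left _ _).trans ?_)
  split_ifs
  · have : (0 : ℝ) ≤ (Fintype.card V : ℝ) := by positivity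
    rw [abs_le]; constructor <;> linarith
  · exact le_rfl

lemma mgVDist_nonneg (c : V) (p : MGPoint G) : 0 ≤ mgVDist G c p := by
  obtain ⟨⟨a, b, s⟩, hp, hs0, hs1⟩ := p
  simp only [mgVDist]
  simp only at hs0 hs1
  have h1 : (0 : ℝ) ≤ 1 - s := by linarith
  refine le_min ?_ ?_ <;> positivity

lemma dist_lt_card (hc : G.Connected) (a b : V) : G.dist a b < Fintype.card V := by
  obtain ⟨p, hp, h⟩ := hc.exists_path_of_dist a b
  rw [← h]; exact hp.length_lt

lemma dist_tri_real (hc : G.Connected) (a b c : V) :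
    (G.dist a c : ℝ) ≤ G.dist a b + G.dist b c := by
  exact_mod_cast hc.dist_triangle

lemma mgDist_le_V (hc : G.Connected) (c c' : V) (p q : MGPoint G) :
    mgDist G p q ≤ mgVDist G c p + G.dist c c' + mgVDist G c' q := by
  obtain ⟨⟨a, b, s⟩, hp, hs0, hs1⟩ := p
  obtain ⟨⟨d, e, t⟩, hq, ht0, ht1⟩ := q
  simp only [mgDist, mgDistAux, mgVDist]
  have key : ∀ x y, (G.dist x y : ℝ) ≤ G.dist c x + G.dist c c' + G.dist c' y := by
    intro x y
    have h1 := dist_tri_real hc x c y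
    have h2 := dist_tri_real hc c c' y
    rw [G.dist_comm (u := x) (v := c)] at h1
    linarith
  refine (min_le_right _ _).trans ?_
  rcases min_cases ((G.dist c a : ℝ) + s) ((G.dist c b : ℝ) + (1 - s)) with h | h <;>
  rcases min_cases ((G.dist c' d : ℝ) + t) ((G.dist c' e : ℝ) + (1 - t)) with h' | h' <;>
  rw [h.1, h'.1]
  · refine (min_le_left _ _).trans ((min_le_left _ _).trans ?_)
    linarith [key a d]
  · refine (min_le_left _ _).trans ((min_le_right _ _).trans ?_)
    linarith [key a e]
  · refine (min_le_right _ _).trans ((min_le_left _ _).trans ?_)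
    linarith [key b d]
  · refine (min_le_right _ _).trans ((min_le_right _ _).trans ?_)
    linarith [key b e]

lemma mgVDist_tri (hc : G.Connected) (c c' : V) (q : MGPoint G) :
    mgVDist G c q ≤ G.dist c c' + mgVDist G c' q := by
  obtain ⟨⟨d, e, t⟩, hq, ht0, ht1⟩ := q
  simp only [mgVDist]
  have h1 := dist_tri_real hc c c' d
  have h2 := dist_tri_real hc c c' e
  rcases min_cases ((G.dist c' d : ℝ) + t) ((G.dist c' e : ℝ) + (1 - t)) with h' | h' <;>
  rw [h'.1]
  · exact (min_le_left _ _).trans (by linarith)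
  · exact (min_le_right _ _).trans (by linarith)

/-- The point with the edge read backwards. -/
def mgFlip (q : MGPoint G) : MGPoint G :=
  ⟨(q.1.2.1, q.1.1, 1 - q.1.2.2), q.2.1.symm, by
    have := q.2.2; constructor <;> [linarith [this.2]; linarith [this.1]]⟩

lemma mgDist_flip (p q : MGPoint G) : mgDist G p (mgFlip q) = mgDist G p q := by
  obtain ⟨⟨a, b, s⟩, hp, hs⟩ := p
  obtain ⟨⟨c, d, t⟩, hq, ht⟩ := q
  simp only [mgDist, mgDistAux, mgFlip, sub_sub_cancel]
  rw [min_comm (ite _ _ _) (ite _ _ _)]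
  congr 1
  rw [min_comm (s + (G.dist a d : ℝ) + (1 - t)), min_comm (1 - s + (G.dist b d : ℝ) + (1 - t))]

lemma mgDist_vertex (hc : G.Connected) (p q : MGPoint G) (h : q.1.2.2 = 0) :
    mgDist G p q = mgVDist G q.1.1 p := by
  obtain ⟨⟨a, b, s⟩, hp, hs0, hs1⟩ := p
  obtain ⟨⟨c, d, t⟩, hq, ht⟩ := q
  simp only at h hq hp hs0 hs1
  subst h
  have hcd : (G.dist d c : ℝ) = 1 := by
    rw [G.dist_comm]; exact_mod_cast SimpleGraph.dist_eq_one_iff_adj.2 hq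
  have h1 := dist_tri_real hc a d c
  have h2 := dist_tri_real hc b d c
  have h3 : (G.dist a c : ℝ) + 1 ≤ Fintype.card V := by exact_mod_cast dist_lt_card hc a c
  simp only [mgDist, mgDistAux, mgVDist]
  rw [G.dist_comm (u := c) (v := a), G.dist_comm (u := c) (v := b)]
  apply le_antisymm
  · refine (min_le_right _ _).trans (min_le_min ?_ ?_)
    · exact (min_le_left _ _).trans (by linarith)
    · exact (min_le_left _ _).trans (by linarith)
  · refine le_min (le_min ?_ ?_) (le_min (le_min ?_ ?_) (le_min ?_ ?_))
    · split_ifs with h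
      · rw [h.1]; refine (min_le_left _ _).trans ?_
        simp [abs_of_nonneg hs0]
      · exact (min_le_left _ _).trans (by linarith)
    · split_ifs with h
      · rw [h.2]; refine (min_le_right _ _).trans ?_
        simp [abs_of_nonpos (sub_nonpos.2 hs1)]
      · exact (min_le_left _ _).trans (by linarith)
    · exact (min_le_left _ _).trans (by linarith)
    · exact (min_le_left _ _).trans (by linarith)
    · exact (min_le_right _ _).trans (by linarith)
    · exact (min_le_right _ _).trans (by linarith)

lemma mgDist_congr (hc : G.Connected) (p q q' : MGPoint G) (h : mgDist G q q' = 0) :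
    mgDist G p q = mgDist G p q' := by
  have vv : ∀ q q' : MGPoint G, q.1.2.2 + (G.dist q.1.1 q'.1.1 : ℝ) + q'.1.2.2 = 0 →
      mgDist G p q = mgDist G p q' := by
    intro q q' h
    have h1 := q.2.2.1
    have h2 := q'.2.2.1
    have h3 : (0 : ℝ) ≤ (G.dist q.1.1 q'.1.1 : ℝ) := by positivity
    have h4 : (G.dist q.1.1 q'.1.1 : ℝ) = 0 := by linarith
    have h5 : q.1.1 = q'.1.1 := hc.dist_eq_zero_iff.1 (by exact_mod_cast h4)
    rw [mgDist_vertex hc p q (by linarith), mgDist_vertex hc p q' (by linarith), h5]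
  have hcard : (Fintype.card V : ℝ) + 1 ≠ 0 := by positivity
  have h' := h
  simp only [mgDist, mgDistAux] at h'
  rcases min_choice (min (if q.1.1 = q'.1.1 ∧ q.1.2.1 = q'.1.2.1 then |q.1.2.2 - q'.1.2.2| else (Fintype.card V : ℝ) + 1)
         (if q.1.1 = q'.1.2.1 ∧ q.1.2.1 = q'.1.1 then |q.1.2.2 - (1 - q'.1.2.2)| else (Fintype.card V : ℝ) + 1))
    (min (min (q.1.2.2 + (G.dist q.1.1 q'.1.1 : ℝ) + q'.1.2.2)
              (q.1.2.2 + (G.dist q.1.1 q'.1.2.1 : ℝ) + (1 - q'.1.2.2)))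
         (min ((1 - q.1.2.2) + (G.dist q.1.2.1 q'.1.1 : ℝ) + q'.1.2.2)
              ((1 - q.1.2.2) + (G.dist q.1.2.1 q'.1.2.1 : ℝ) + (1 - q'.1.2.2)))) with e | e
  · rw [e] at h'
    rcases min_choice (if q.1.1 = q'.1.1 ∧ q.1.2.1 = q'.1.2.1 then |q.1.2.2 - q'.1.2.2| else (Fintype.card V : ℝ) + 1)
         (if q.1.1 = q'.1.2.1 ∧ q.1.2.1 = q'.1.1 then |q.1.2.2 - (1 - q'.1.2.2)| else (Fintype.card V : ℝ) + 1) with e2 | e2 <;>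
    rw [e2] at h' <;> split_ifs at h' with h0
    · have : q = q' := Subtype.ext (Prod.ext h0.1 (Prod.ext h0.2 (by linarith [abs_eq_zero.1 h'])))
      rw [this]
    · exact absurd h' hcard
    · have : q = mgFlip q' := Subtype.ext (Prod.ext h0.1 (Prod.ext h0.2 (by
        simp only [mgFlip]; linarith [abs_eq_zero.1 h'])))
      rw [this, mgDist_flip]
    · exact absurd h' hcard
  · rw [e] at h'
    rcases min_choice (min (q.1.2.2 + (G.dist q.1.1 q'.1.1 : ℝ) + q'.1.2.2)
              (q.1.2.2 + (G.dist q.1.1 q'.1.2.1 : ℝ) + (1 - q'.1.2.2)))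
         (min ((1 - q.1.2.2) + (G.dist q.1.2.1 q'.1.1 : ℝ) + q'.1.2.2)
              ((1 - q.1.2.2) + (G.dist q.1.2.1 q'.1.2.1 : ℝ) + (1 - q'.1.2.2))) with e2 | e2 <;>
    rw [e2] at h'
    · rcases min_choice (q.1.2.2 + (G.dist q.1.1 q'.1.1 : ℝ) + q'.1.2.2)
              (q.1.2.2 + (G.dist q.1.1 q'.1.2.1 : ℝ) + (1 - q'.1.2.2)) with e3 | e3 <;> rw [e3] at h'
      · exact vv q q' h'
      · rw [← mgDist_flip p q']; exact vv q (mgFlip q') h'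
    · rcases min_choice ((1 - q.1.2.2) + (G.dist q.1.2.1 q'.1.1 : ℝ) + q'.1.2.2)
              ((1 - q.1.2.2) + (G.dist q.1.2.1 q'.1.2.1 : ℝ) + (1 - q'.1.2.2)) with e3 | e3 <;> rw [e3] at h'
      · rw [← mgDist_flip p q]; exact vv (mgFlip q) q' h'
      · rw [← mgDist_flip p q, ← mgDist_flip p q']; exact vv (mgFlip q) (mgFlip q') h'

lemma triangleDelta_bdd (T : MGTriangle G) (d : ℝ) (hd : 0 ≤ d)
    (h1 : ∀ s ∈ Set.Icc T.a1 T.b1,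
      (∃ t ∈ Set.Icc T.a2 T.b2, mgDist G (T.g1 s) (T.g2 t) ≤ d) ∨
      (∃ t ∈ Set.Icc T.a3 T.b3, mgDist G (T.g1 s) (T.g3 t) ≤ d))
    (h2 : ∀ s ∈ Set.Icc T.a2 T.b2,
      (∃ t ∈ Set.Icc T.a1 T.b1, mgDist G (T.g2 s) (T.g1 t) ≤ d) ∨
      (∃ t ∈ Set.Icc T.a3 T.b3, mgDist G (T.g2 s) (T.g3 t) ≤ d))
    (h3 : ∀ s ∈ Set.Icc T.a3 T.b3,
      (∃ t ∈ Set.Icc T.a1 T.b1, mgDist G (T.g3 s) (T.g1 t) ≤ d) ∨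
      (∃ t ∈ Set.Icc T.a2 T.b2, mgDist G (T.g3 s) (T.g2 t) ≤ d)) :
    triangleDelta T ≤ d :=
  csInf_le ⟨0, fun _ hx => hx.1⟩ ⟨hd, h1, h2, h3⟩

lemma card_feasible (T : MGTriangle G) :
    (Fintype.card V : ℝ) + 1 ∈ {d : ℝ | 0 ≤ d ∧
    (∀ s ∈ Set.Icc T.a1 T.b1,
      (∃ t ∈ Set.Icc T.a2 T.b2, mgDist G (T.g1 s) (T.g2 t) ≤ d) ∨
      (∃ t ∈ Set.Icc T.a3 T.b3, mgDist G (T.g1 s) (T.g3 t) ≤ d)) ∧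
    (∀ s ∈ Set.Icc T.a2 T.b2,
      (∃ t ∈ Set.Icc T.a1 T.b1, mgDist G (T.g2 s) (T.g1 t) ≤ d) ∨
      (∃ t ∈ Set.Icc T.a3 T.b3, mgDist G (T.g2 s) (T.g3 t) ≤ d)) ∧
    (∀ s ∈ Set.Icc T.a3 T.b3,
      (∃ t ∈ Set.Icc T.a1 T.b1, mgDist G (T.g3 s) (T.g1 t) ≤ d) ∨
      (∃ t ∈ Set.Icc T.a2 T.b2, mgDist G (T.g3 s) (T.g2 t) ≤ d))} :=
  ⟨by positivity,
    fun _ _ => Or.inl ⟨T.a2, ⟨le_rfl, T.h2.1⟩, mgDist_le_card _ _⟩,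
    fun _ _ => Or.inl ⟨T.a1, ⟨le_rfl, T.h1.1⟩, mgDist_le_card _ _⟩,
    fun _ _ => Or.inl ⟨T.a1, ⟨le_rfl, T.h1.1⟩, mgDist_le_card _ _⟩⟩

lemma triangleDelta_le_hypDelta (T : MGTriangle G) : triangleDelta T ≤ hypDelta G := by
  refine le_csSup ⟨(Fintype.card V : ℝ) + 1, ?_⟩ ⟨T, rfl⟩
  rintro d ⟨T, rfl⟩
  exact csInf_le ⟨0, fun _ hx => hx.1⟩ (card_feasible T)

end MetricLemmas

section LowerBound

variable {V : Type} [Fintype V] [DecidableEq V] {G : SimpleGraph V}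

lemma exists_walk_seq (H : SimpleGraph V) (c : ℕ → V) (a b : ℕ) (hab : a ≤ b)
    (h : ∀ k, a ≤ k → k < b → H.Adj (c k) (c (k + 1))) :
    ∃ w : H.Walk (c a) (c b), w.length = b - a := by
  induction b, hab using Nat.le_induction with
  | base => exact ⟨Walk.nil, by simp⟩
  | succ b hb ih =>
    obtain ⟨w, hw⟩ := ih (fun k h1 h2 => h k h1 (by omega))
    exact ⟨w.concat (h b hb (by omega)), by simp [hw]; omega⟩

lemma cycle_arc {a : V} (w : G.Walk a a) (hw : w.IsCycle) (i j : ℕ) (hij : i < j)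
    (hj : j ≤ w.length) (hne : ¬ (i = 0 ∧ j = w.length)) :
    ∃ Q : G.Walk (w.getVert i) (w.getVert j), Q.IsPath ∧ Q.length = j - i := by
  rcases hj.lt_or_eq with h | h
  · have h1 : (w.take j).getVert i = w.getVert i := by
      rw [Walk.take_getVert]; congr 1; omega
    refine ⟨((w.take j).drop i).copy h1 rfl, ?_, ?_⟩
    · rw [Walk.isPath_copy]
      exact (hw.isPath_take h).drop i
    · simp; omega
  · subst h
    refine ⟨(w.drop i).copy rfl (by simp), ?_, ?_⟩
    · rw [Walk.isPath_copy]
      exact hw.isPath_drop (by omega)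
    · simp

lemma cycle_isometric (hc : G.Connected) {a : V} (w : G.Walk a a) (hw : w.IsCycle)
    (hg : G.girth = w.length) (i j : ℕ) (hij : i < j) (hj : j ≤ w.length) :
    min (j - i) (w.length - (j - i)) ≤ G.dist (w.getVert i) (w.getVert j) := by
  by_contra hlt
  push Not at hlt
  obtain ⟨Q, hQ, hQl⟩ := cycle_arc w hw i j hij hj (by rintro ⟨h1, h2⟩; subst h1; simp [h2] at hlt)
  obtain ⟨P, hP, hPl⟩ := hc.exists_path_of_dist (w.getVert i) (w.getVert j)
  have hne : P ≠ Q := by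
    intro h
    rw [h, hQl] at hPl
    rw [← hPl] at hlt
    simp at hlt
  obtain ⟨x, _, _, C, hC, hCl⟩ := hP.exists_isCycle_length_le_add_of_ne hQ hne
  have := SimpleGraph.girth_le_length hC
  rw [hg] at this
  have h1 := lt_of_lt_of_le hlt (min_le_right _ _)
  omega

lemma cycle_isometric_real (hc : G.Connected) {a : V} (w : G.Walk a a) (hw : w.IsCycle)
    (hg : G.girth = w.length) (i j : ℕ) (hi : i ≤ w.length) (hj : j ≤ w.length) :
    |(i : ℝ) - j| ≤ G.dist (w.getVert i) (w.getVert j) ∨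
    w.length - |(i : ℝ) - j| ≤ G.dist (w.getVert i) (w.getVert j) := by
  wlog h : i ≤ j generalizing i j
  · rw [abs_sub_comm, G.dist_comm]
    exact this j i hj hi (by omega)
  rcases h.lt_or_eq with h | h
  · have := cycle_isometric hc w hw hg i j h hj
    have e : |(i : ℝ) - j| = ((j - i : ℕ) : ℝ) := by
      rw [abs_sub_comm, Nat.cast_sub h.le, abs_of_nonneg]
      have : (i : ℝ) ≤ j := by exact_mod_cast h.le
      linarith
    rw [e]
    rcases min_le_iff.1 this with h1 | h1
    · left; exact_mod_cast h1
    · right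
      have h2 : ((w.length - (j - i) : ℕ) : ℝ) ≤ G.dist (w.getVert i) (w.getVert j) := by
        exact_mod_cast h1
      rwa [Nat.cast_sub (by omega)] at h2
  · left; subst h; simp

lemma exists_cell (N : ℕ) (hN : 1 ≤ N) (s : ℝ) (hs : s ∈ Set.Icc (0 : ℝ) N) :
    ∃ i : ℕ, i < N ∧ (i : ℝ) ≤ s ∧ s ≤ i + 1 := by
  by_cases h : s < N
  · refine ⟨⌊s⌋₊, ?_, Nat.floor_le hs.1, (Nat.lt_floor_add_one s).le⟩
    exact (Nat.floor_lt hs.1).2 h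
  · refine ⟨N - 1, by omega, ?_, ?_⟩ <;> rw [Nat.cast_sub hN] <;> push_cast <;>
      linarith [hs.1, hs.2]

/-- Distances between points of a shortest cycle. -/
lemma cycle_points_lower (hc : G.Connected) {a : V} (w : G.Walk a a) (hw : w.IsCycle)
    (hg : G.girth = w.length) (p q : MGPoint G) (s t : ℝ) (i j : ℕ)
    (hi : i < w.length) (hj : j < w.length)
    (his : (i : ℝ) ≤ s ∧ s ≤ i + 1) (hjt : (j : ℝ) ≤ t ∧ t ≤ j + 1)
    (hp : p.1 = (w.getVert i, w.getVert (i + 1), s - i))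
    (hq : q.1 = (w.getVert j, w.getVert (j + 1), t - j))
    (D : ℝ) (hD1 : D ≤ |s - t|) (hD2 : D ≤ w.length - |s - t|) :
    D ≤ mgDist G p q := by
  have hL := hw.three_le_length
  have hcard : w.length ≤ Fintype.card V := by
    have := hw.isPath_tail.length_lt
    have := w.length_tail_add_one hw.not_nil
    omega
  have hcard' : (w.length : ℝ) ≤ Fintype.card V := by exact_mod_cast hcard
  simp only [mgDist, mgDistAux, hp, hq]
  have iso := cycle_isometric_real hc w hw hg
  have inj : ∀ k l : ℕ, k < w.length → l < w.length → w.getVert k = w.getVert l → k = l := by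
    intro k l hk hl h
    exact hw.getVert_injOn' (by simp only [Set.mem_ofPred_eq]; omega)
      (by simp only [Set.mem_ofPred_eq]; omega) h
  have inj2 : ∀ k l : ℕ, k ≤ w.length → l ≤ w.length → w.getVert k = w.getVert l →
      k = l ∨ (k = 0 ∧ l = w.length) ∨ (l = 0 ∧ k = w.length) := by
    intro k l hk hl h
    have h0 : w.getVert w.length = w.getVert 0 := by simp
    rcases hk.lt_or_eq with hk | hk <;> rcases hl.lt_or_eq with hl | hl
    · left; exact inj k l hk hl h
    · subst hl
      rw [h0] at h
      have := inj k 0 hk (by omega) h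
      tauto
    · subst hk
      rw [h0] at h
      have := inj 0 l (by omega) hl h
      omega
    · omega
  refine le_min (le_min ?_ ?_) (le_min (le_min ?_ ?_) (le_min ?_ ?_))
  · split_ifs with h
    · have := inj i j hi hj h.1
      subst this
      refine hD1.trans (le_of_eq ?_)
      congr 1; ring
    · linarith
  · split_ifs with h
    · exfalso
      have h1 := inj2 _ _ hi.le hj h.1
      have h2 := inj2 _ _ hi hj.le h.2
      omega
    · linarith
  · rcases iso i j hi.le hj.le with h | h <;>
    rcases abs_cases ((i : ℝ) - j) with h1 | h1 <;> rcases abs_cases (s - t) with h2 | h2 <;>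
    linarith
  · have h := iso i (j + 1) hi.le hj
    push_cast at h
    rcases h with h | h <;>
    rcases abs_cases ((i : ℝ) - (j + 1)) with h1 | h1 <;> rcases abs_cases (s - t) with h2 | h2 <;>
    linarith
  · have h := iso (i + 1) j hi hj.le
    push_cast at h
    rcases h with h | h <;>
    rcases abs_cases ((i : ℝ) + 1 - j) with h1 | h1 <;> rcases abs_cases (s - t) with h2 | h2 <;>
    linarith
  · have h := iso (i + 1) (j + 1) hi hj
    push_cast at h
    rcases h with h | h <;>
    rcases abs_cases ((i : ℝ) + 1 - (j + 1)) with h1 | h1 <;>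
    rcases abs_cases (s - t) with h2 | h2 <;>
    linarith

lemma cycle_points (hc : G.Connected) {a : V} (w : G.Walk a a) (hw : w.IsCycle)
    (hg : G.girth = w.length) (p q : MGPoint G) (s t : ℝ) (i j : ℕ)
    (hi : i < w.length) (hj : j < w.length)
    (his : (i : ℝ) ≤ s ∧ s ≤ i + 1) (hjt : (j : ℝ) ≤ t ∧ t ≤ j + 1)
    (hp : p.1 = (w.getVert i, w.getVert (i + 1), s - i))
    (hq : q.1 = (w.getVert j, w.getVert (j + 1), t - j))
    (hst : 2 * |s - t| ≤ w.length) :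
    mgDist G p q = |s - t| := by
  have hL := hw.three_le_length
  have hcard : w.length ≤ Fintype.card V := by
    have := hw.isPath_tail.length_lt
    have := w.length_tail_add_one hw.not_nil
    omega
  have hcard' : (w.length : ℝ) ≤ Fintype.card V := by exact_mod_cast hcard
  apply le_antisymm
  · -- upper bound
    simp only [mgDist, mgDistAux, hp, hq]
    have up : ∀ i j : ℕ, i ≤ j → j ≤ w.length →
        (G.dist (w.getVert i) (w.getVert j) : ℝ) ≤ (j : ℝ) - i := by
      intro i j hij hj
      obtain ⟨W, hW⟩ := exists_walk_seq G w.getVert i j hij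
        (fun k _ h2 => w.adj_getVert_succ (by omega))
      rw [← Nat.cast_sub hij, ← hW]
      exact_mod_cast SimpleGraph.dist_le W
    rcases lt_trichotomy i j with h | h | h
    · have h1 := up (i + 1) j h hj.le
      push_cast at h1
      refine (min_le_right _ _).trans ((min_le_right _ _).trans ((min_le_left _ _).trans ?_))
      rw [abs_sub_comm]
      refine le_trans ?_ (le_abs_self _)
      linarith
    · subst h
      refine (min_le_left _ _).trans ((min_le_left _ _).trans ?_)
      simp
    · have h1 := up (j + 1) i h hi.le
      push_cast at h1
      refine (min_le_right _ _).trans ((min_le_left _ _).trans ((min_le_right _ _).trans ?_))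
      refine le_trans ?_ (le_abs_self _)
      rw [G.dist_comm]
      linarith
  · exact cycle_points_lower hc w hw hg p q s t i j hi hj his hjt hp hq _ le_rfl (by linarith)

lemma hypDelta_lower (hc : G.Connected) (u : ℕ) (hu : 1 ≤ u) (hg : G.girth = 4 * u) :
    (u : ℝ) ≤ hypDelta G := by
  have hna : ¬ G.IsAcyclic := by
    intro h
    rw [SimpleGraph.girth_eq_zero.2 h] at hg
    omega
  obtain ⟨a, w, hw, hwl⟩ := SimpleGraph.exists_girth_eq_length.2 hna
  have hL : w.length = 4 * u := by omega
  have hLr : (w.length : ℝ) = 4 * u := by rw [hL]; push_cast; ring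
  have hur : (1 : ℝ) ≤ u := by exact_mod_cast hu
  have cell := exists_cell w.length (by omega)
  have ex : ∀ s : ℝ, ∃ p : MGPoint G, s ∈ Set.Icc (0 : ℝ) w.length →
      ∃ i : ℕ, i < w.length ∧ ((i : ℝ) ≤ s ∧ s ≤ i + 1) ∧
        p.1 = (w.getVert i, w.getVert (i + 1), s - i) := by
    intro s
    by_cases hs : s ∈ Set.Icc (0 : ℝ) w.length
    · obtain ⟨i, h1, h2, h3⟩ := cell s hs
      exact ⟨⟨(w.getVert i, w.getVert (i + 1), s - i), w.adj_getVert_succ h1,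
        by constructor <;> simp only <;> linarith⟩, fun _ => ⟨i, h1, ⟨h2, h3⟩, rfl⟩⟩
    · exact ⟨⟨(w.getVert 0, w.getVert 1, 0), w.adj_getVert_succ (by omega), by simp⟩,
        fun h => absurd h hs⟩
  choose γ hγ using ex
  have dist1 : ∀ s ∈ Set.Icc (0 : ℝ) w.length, ∀ t ∈ Set.Icc (0 : ℝ) w.length,
      2 * |s - t| ≤ w.length → mgDist G (γ s) (γ t) = |s - t| := by
    intro s hs t ht h
    obtain ⟨i, h1, h2, h3⟩ := hγ s hs
    obtain ⟨j, h4, h5, h6⟩ := hγ t ht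
    exact cycle_points hc w hw hwl _ _ s t i j h1 h4 h2 h5 h3 h6 h
  have g1 : IsMGGeodesic G 0 (2 * u) γ := by
    refine ⟨by positivity, fun s hs t ht => dist1 s ⟨hs.1, by linarith [hs.2]⟩ t
      ⟨ht.1, by linarith [ht.2]⟩ ?_⟩
    rcases abs_cases (s - t) with h2 | h2 <;> linarith [hs.1, hs.2, ht.1, ht.2]
  have g2 : IsMGGeodesic G (2 * u) (4 * u) γ := by
    refine ⟨by linarith, fun s hs t ht => dist1 s ⟨by linarith [hs.1], by linarith [hs.2]⟩ t
      ⟨by linarith [ht.1], by linarith [ht.2]⟩ ?_⟩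
    rcases abs_cases (s - t) with h2 | h2 <;> linarith [hs.1, hs.2, ht.1, ht.2]
  have g3 : IsMGGeodesic G 0 0 γ := by
    refine ⟨le_rfl, fun s hs t ht => dist1 s ⟨by linarith [hs.1], by linarith [hs.2]⟩ t
      ⟨by linarith [ht.1], by linarith [ht.2]⟩ ?_⟩
    rcases abs_cases (s - t) with h2 | h2 <;> linarith [hs.1, hs.2, ht.1, ht.2]
  have self : ∀ s ∈ Set.Icc (0 : ℝ) w.length, mgDist G (γ s) (γ s) = 0 := by
    intro s hs
    rw [dist1 s hs s hs (by simp)]; simp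
  -- the closing point
  have h0 : mgDist G (γ (4 * u)) (γ 0) = 0 := by
    apply le_antisymm _ (mgDist_nonneg _ _)
    obtain ⟨i, h1, h2, h3⟩ := hγ (4 * u) ⟨by positivity, by linarith⟩
    obtain ⟨j, h4, h5, h6⟩ := hγ 0 ⟨le_rfl, by positivity⟩
    have hi : i + 1 = w.length := by
      have : (w.length : ℝ) ≤ ((i + 1 : ℕ) : ℝ) := by push_cast; linarith [h2.2]
      have : w.length ≤ i + 1 := by exact_mod_cast this
      omega
    have hj : j = 0 := by
      have : (j : ℝ) ≤ ((0 : ℕ) : ℝ) := by push_cast; exact h5.1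
      have : j ≤ 0 := by exact_mod_cast this
      omega
    subst hj
    have hir : (i : ℝ) + 1 = 4 * u := by rw [← hLr, ← hi]; push_cast; ring
    simp only [mgDist, mgDistAux, h3, h6, hi]
    refine (min_le_right _ _).trans ((min_le_right _ _).trans ((min_le_left _ _).trans ?_))
    simp
    linarith
  let T : MGTriangle G :=
    { a1 := 0, b1 := 2 * u, a2 := 2 * u, b2 := 4 * u, a3 := 0, b3 := 0
      g1 := γ, g2 := γ, g3 := γ, h1 := g1, h2 := g2, h3 := g3
      glue1 := self _ ⟨by positivity, by linarith⟩
      glue2 := h0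
      glue3 := self _ ⟨by positivity, by linarith⟩ }
  refine le_trans ?_ (triangleDelta_le_hypDelta T)
  refine le_csInf ⟨_, card_feasible T⟩ ?_
  rintro d ⟨_, hd, _, _⟩
  rcases hd u ⟨by positivity, by change (u : ℝ) ≤ 2 * u; linarith⟩ with ⟨t, ht, h⟩ | ⟨t, ht, h⟩
  · change t ∈ Set.Icc (2 * (u : ℝ)) (4 * u) at ht
    change mgDist G (γ u) (γ t) ≤ d at h
    by_cases h3 : t ≤ 3 * u
    · rw [dist1 u ⟨by positivity, by linarith⟩ t ⟨by linarith [ht.1], by linarith [ht.2]⟩ (by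
        rcases abs_cases ((u : ℝ) - t) with h2 | h2 <;> linarith [ht.1, ht.2])] at h
      rcases abs_cases ((u : ℝ) - t) with h2 | h2 <;> linarith [ht.1, ht.2]
    · -- going round the other way
      push Not at h3
      obtain ⟨i, h1, h2, hi⟩ := hγ u ⟨by positivity, by linarith⟩
      obtain ⟨j, h4, h5, hj⟩ := hγ t ⟨by linarith [ht.1], by linarith [ht.2]⟩
      refine le_trans ?_ h
      have e : |(u : ℝ) - t| = t - u := by
        rw [abs_sub_comm, abs_of_nonneg]; linarith [ht.1]
      exact cycle_points_lower hc w hw hwl _ _ _ t i j h1 h4 h2 h5 hi hj u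
        (by rw [e]; linarith [ht.1]) (by rw [e]; linarith [ht.2])
  · change t ∈ Set.Icc (0 : ℝ) 0 at ht
    change mgDist G (γ u) (γ t) ≤ d at h
    have : t = 0 := le_antisymm ht.2 ht.1
    subst this
    rw [dist1 u ⟨by positivity, by linarith⟩ 0 ⟨by linarith [ht.1], by linarith [ht.2]⟩ (by
        rw [sub_zero, abs_of_nonneg (by positivity)]; linarith)] at h
    rw [sub_zero, abs_of_nonneg (by positivity)] at h
    exact h

end LowerBound

section UpperBound

variable {V : Type} [Fintype V] [DecidableEq V] {G : SimpleGraph V}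

/-- The point is represented on an edge with end `l`. -/
def mgOn (l : V) (p : MGPoint G) : Prop := p.1.1 = l ∨ p.1.2.1 = l

lemma mgVDist_flip (c : V) (p : MGPoint G) : mgVDist G c (mgFlip p) = mgVDist G c p := by
  simp only [mgVDist, mgFlip, sub_sub_cancel]
  rw [min_comm]

lemma mgDist_flip_left (p q : MGPoint G) : mgDist G (mgFlip p) q = mgDist G p q := by
  rw [mgDist_comm, mgDist_flip, mgDist_comm]

lemma leaf_dist (hc : G.Connected) (v0 l : V) (hl : ∀ x, G.Adj l x → x = v0) (c : V) (hcl : c ≠ l) :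
    (1 : ℝ) + G.dist v0 c ≤ G.dist l c := by
  obtain ⟨p, hp⟩ := hc.exists_walk_length_eq_dist l c
  cases p with
  | nil => exact absurd rfl hcl
  | cons h p =>
    have h1 : G.dist v0 c ≤ p.length := by
      have := hl _ h
      subst this
      exact SimpleGraph.dist_le p
    rw [← hp, Walk.length_cons]
    have : (G.dist v0 c : ℝ) ≤ p.length := by exact_mod_cast h1
    push_cast
    linarith

lemma leaf_V (v0 l : V) (hl : ∀ x, G.Adj l x → x = v0)
    (x : MGPoint G) (h2 : x.1.2.1 = l) :
    x.1.1 = v0 ∧ mgVDist G v0 x = x.1.2.2 := by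
  have h1 : x.1.1 = v0 := hl _ (h2 ▸ x.2.1.symm)
  refine ⟨h1, ?_⟩
  have hadj : G.Adj v0 x.1.2.1 := h1 ▸ x.2.1
  have : (G.dist v0 x.1.2.1 : ℝ) = 1 := by exact_mod_cast SimpleGraph.dist_eq_one_iff_adj.2 hadj
  have h3 := x.2.2.1
  have h4 := x.2.2.2
  simp only [mgVDist, h1, this, SimpleGraph.dist_self]
  rw [min_eq_left]
  · simp
  · push_cast; linarith

lemma leaf_V_le (v0 l : V) (hl : ∀ x, G.Adj l x → x = v0)
    (x : MGPoint G) (h : mgOn l x) : mgVDist G v0 x ≤ 1 := by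
  rcases h with h | h
  · rw [← mgVDist_flip, (leaf_V v0 l hl (mgFlip x) h).2]
    exact (mgFlip x).2.2.2
  · rw [(leaf_V v0 l hl x h).2]
    exact x.2.2.2

lemma leaf_sep (hc : G.Connected) (v0 l : V) (hl : ∀ x, G.Adj l x → x = v0)
    (x w : MGPoint G) (hx : mgOn l x) (hw : ¬ mgOn l w) :
    mgDist G x w = mgVDist G v0 x + mgVDist G v0 w := by
  have main : ∀ x : MGPoint G, x.1.2.1 = l →
      mgDist G x w = mgVDist G v0 x + mgVDist G v0 w := by
    intro x hx
    obtain ⟨h1, h2⟩ := leaf_V v0 l hl x hx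
    apply le_antisymm
    · have := mgDist_le_V hc v0 v0 x w
      simpa using this
    · rw [h2]
      obtain ⟨⟨a, b, s⟩, hp, hs0, hs1⟩ := x
      obtain ⟨⟨c, d, t⟩, hq, ht0, ht1⟩ := w
      simp only at hp hs0 hs1 hq ht0 ht1 h1 h2 hx
      subst h1 hx
      simp only [mgOn, not_or] at hw
      have d1 := leaf_dist hc a b hl c hw.1
      have d2 := leaf_dist hc a b hl d hw.2
      have d3 : (G.dist a c : ℝ) + 1 ≤ Fintype.card V := by exact_mod_cast dist_lt_card hc a c
      have d4 : (G.dist a d : ℝ) + 1 ≤ Fintype.card V := by exact_mod_cast dist_lt_card hc a d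
      simp only [mgDist, mgDistAux, mgVDist]
      have m1 := min_le_left ((G.dist a c : ℝ) + t) ((G.dist a d : ℝ) + (1 - t))
      have m2 := min_le_right ((G.dist a c : ℝ) + t) ((G.dist a d : ℝ) + (1 - t))
      refine le_min (le_min ?_ ?_) (le_min (le_min ?_ ?_) (le_min ?_ ?_))
      · rw [if_neg (fun h => hw.2 h.2.symm)]; linarith
      · rw [if_neg (fun h => hw.1 h.2.symm)]; linarith
      all_goals linarith
  rcases hx with h | h
  · rw [← mgDist_flip_left, ← mgVDist_flip]
    exact main (mgFlip x) h
  · exact main x h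

lemma geod_pass (hc : G.Connected) (v0 l : V) (hl : ∀ x, G.Adj l x → x = v0) (a b : ℝ)
    (γ : ℝ → MGPoint G) (hγ : IsMGGeodesic G a b γ) (h1 : mgOn l (γ b)) (h2 : ¬ mgOn l (γ a)) :
    ∃ t ∈ Set.Icc a b, mgVDist G v0 (γ t) = 0 := by
  obtain ⟨hab, hd⟩ := hγ
  have e := leaf_sep hc v0 l hl _ _ h1 h2
  rw [hd b ⟨hab, le_rfl⟩ a ⟨le_rfl, hab⟩, abs_of_nonneg (by linarith)] at e
  have n1 := mgVDist_nonneg v0 (γ a)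
  have n2 := mgVDist_nonneg v0 (γ b)
  have ht : b - mgVDist G v0 (γ b) ∈ Set.Icc a b := ⟨by linarith, by linarith⟩
  refine ⟨_, ht, ?_⟩
  by_cases h : mgOn l (γ (b - mgVDist G v0 (γ b)))
  · have e2 := leaf_sep hc v0 l hl _ _ h h2
    rw [hd _ ht a ⟨le_rfl, hab⟩, abs_of_nonneg (by linarith)] at e2
    linarith
  · have e2 := leaf_sep hc v0 l hl _ _ h1 h
    rw [hd b ⟨hab, le_rfl⟩ _ ht, abs_of_nonneg (by linarith)] at e2
    linarith

lemma geod_reverse (a b : ℝ) (γ : ℝ → MGPoint G) (hγ : IsMGGeodesic G a b γ) :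
    IsMGGeodesic G (-b) (-a) (fun s => γ (-s)) := by
  refine ⟨by linarith [hγ.1], fun s hs t ht => ?_⟩
  rw [hγ.2 (-s) ⟨by linarith [hs.2], by linarith [hs.1]⟩ (-t)
    ⟨by linarith [ht.2], by linarith [ht.1]⟩]
  rw [show -s - -t = -(s - t) by ring, abs_neg]

/-- Structural hypotheses: a graph with leaves hanging at `v0` such that each point off the leaf
edges is on a path of length `u` from some `A i` to some `B j`. -/
structure CoreData (G : SimpleGraph V) (u : ℕ) (v0 : V) (Lf : V → Prop) (A B : Fin 3 → V) :
    Prop where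
  leaf : ∀ l x, Lf l → G.Adj l x → x = v0
  v0B : ∀ j, G.dist v0 (B j) ≤ u
  AB : ∀ i j, G.dist (A i) (B j) ≤ u
  core : ∀ x y, G.Adj x y → ¬ Lf x → ¬ Lf y → ∃ i j, ∃ k k' : ℕ,
    G.dist (A i) x ≤ k ∧ G.dist (B j) y ≤ k' ∧ k + 1 + k' = u ∨
    G.dist (A i) y ≤ k ∧ G.dist (B j) x ≤ k' ∧ k + 1 + k' = u

variable {u : ℕ} {v0 : V} {Lf : V → Prop} {A B : Fin 3 → V}

lemma core_pos (H : CoreData G u v0 Lf A B) (p : MGPoint G) (h1 : ¬ Lf p.1.1)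
    (h2 : ¬ Lf p.1.2.1) : ∃ i j, ∃ s : ℝ, mgVDist G (A i) p ≤ s ∧ mgVDist G (B j) p ≤ u - s ∧
      0 ≤ s ∧ s ≤ u := by
  obtain ⟨i, j, k, k', h⟩ := H.core _ _ p.2.1 h1 h2
  have hs0 := p.2.2.1
  have hs1 := p.2.2.2
  have n1 := mgVDist_nonneg (A i) p
  have n2 := mgVDist_nonneg (B j) p
  rcases h with ⟨h3, h4, h5⟩ | ⟨h3, h4, h5⟩
  · have h3' : (G.dist (A i) p.1.1 : ℝ) ≤ k := by exact_mod_cast h3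
    have h4' : (G.dist (B j) p.1.2.1 : ℝ) ≤ k' := by exact_mod_cast h4
    have h5' : (k : ℝ) + 1 + k' = u := by exact_mod_cast h5
    have e1 : mgVDist G (A i) p ≤ k + p.1.2.2 := (min_le_left _ _).trans (by linarith)
    have e2 : mgVDist G (B j) p ≤ u - (k + p.1.2.2) := (min_le_right _ _).trans (by linarith)
    exact ⟨i, j, k + p.1.2.2, e1, e2, by linarith, by linarith⟩
  · have h3' : (G.dist (A i) p.1.2.1 : ℝ) ≤ k := by exact_mod_cast h3
    have h4' : (G.dist (B j) p.1.1 : ℝ) ≤ k' := by exact_mod_cast h4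
    have h5' : (k : ℝ) + 1 + k' = u := by exact_mod_cast h5
    have e1 : mgVDist G (A i) p ≤ k + (1 - p.1.2.2) := (min_le_right _ _).trans (by linarith)
    have e2 : mgVDist G (B j) p ≤ u - (k + (1 - p.1.2.2)) := (min_le_left _ _).trans (by linarith)
    exact ⟨i, j, k + (1 - p.1.2.2), e1, e2, by linarith, by linarith⟩

lemma core_V (hc : G.Connected) (H : CoreData G u v0 Lf A B) (p : MGPoint G) (h1 : ¬ Lf p.1.1)
    (h2 : ¬ Lf p.1.2.1) : mgVDist G v0 p ≤ 2 * u := by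
  obtain ⟨i, j, s, e1, e2, e3, e4⟩ := core_pos H p h1 h2
  have := mgVDist_tri hc v0 (B j) p
  have h : (G.dist v0 (B j) : ℝ) ≤ u := by exact_mod_cast H.v0B j
  linarith

lemma core_diam (hc : G.Connected) (H : CoreData G u v0 Lf A B) (p q : MGPoint G)
    (h1 : ¬ Lf p.1.1) (h2 : ¬ Lf p.1.2.1) (h3 : ¬ Lf q.1.1) (h4 : ¬ Lf q.1.2.1) :
    mgDist G p q ≤ 2 * u := by
  obtain ⟨i, j, s, e1, e2, e3, e4⟩ := core_pos H p h1 h2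
  obtain ⟨i', j', t, f1, f2, f3, f4⟩ := core_pos H q h3 h4
  have k1 := mgDist_le_V hc (A i) (B j') p q
  have k2 := mgDist_le_V hc (B j) (A i') p q
  have d1 : (G.dist (A i) (B j') : ℝ) ≤ u := by exact_mod_cast H.AB i j'
  have d2 : (G.dist (B j) (A i') : ℝ) ≤ u := by
    rw [G.dist_comm]; exact_mod_cast H.AB i' j
  by_contra hlt
  linarith

lemma same_leaf (l : V) (hc : G.Connected) (hl : ∀ x, G.Adj l x → x = v0) (x y : MGPoint G)
    (hx : mgOn l x) (hy : mgOn l y) : mgDist G x y ≤ 2 := by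
  have := mgDist_le_V hc v0 v0 x y
  have h1 := leaf_V_le v0 l hl x hx
  have h2 := leaf_V_le v0 l hl y hy
  simp at this
  linarith

lemma side_case (hc : G.Connected) (hu : 1 ≤ u) (H : CoreData G u v0 Lf A B)
    (a b a' b' a'' b'' : ℝ) (γ γ' γ'' : ℝ → MGPoint G)
    (h : IsMGGeodesic G a b γ) (h' : IsMGGeodesic G a' b' γ') (h'' : IsMGGeodesic G a'' b'' γ'')
    (g1 : mgDist G (γ b) (γ' a') = 0) (g2 : mgDist G (γ' b') (γ'' a'') = 0)
    (g3 : mgDist G (γ'' b'') (γ a) = 0) (s : ℝ) (hs : s ∈ Set.Icc a b)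
    (hbs : u < b - s) (l : V) (hLf : Lf l) (hX : mgOn l (γ a))
    (hlong : 2 * (u : ℝ) < b - a) :
    (∃ t ∈ Set.Icc a' b', mgDist G (γ s) (γ' t) ≤ u) ∨
    (∃ t ∈ Set.Icc a'' b'', mgDist G (γ s) (γ'' t) ≤ u) := by
  have hl := fun x => H.leaf l x hLf
  have hur : (1 : ℝ) ≤ u := by exact_mod_cast hu
  have hdist : mgDist G (γ a) (γ b) = b - a := by
    rw [h.2 a ⟨le_rfl, h.1⟩ b ⟨h.1, le_rfl⟩, abs_sub_comm, abs_of_nonneg (by linarith [h.1])]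
  have hV := mgDist_le_V hc v0 v0 (γ a) (γ b)
  rw [SimpleGraph.dist_self] at hV
  have hVX := leaf_V_le v0 l hl _ hX
  -- `γ b` is in the core
  have hYn : ∀ l', Lf l' → ¬ mgOn l' (γ b) := by
    intro l' hl' hon
    have := leaf_V_le v0 l' (fun x => H.leaf l' x hl') _ hon
    push_cast at hV
    linarith
  have hVY := core_V hc H (γ b) (fun hh => hYn _ hh (Or.inl rfl)) (fun hh => hYn _ hh (Or.inr rfl))
  have hY := hYn l hLf
  have eXY := leaf_sep hc v0 l hl _ _ hX hY
  have hVP : mgVDist G v0 (γ s) ≤ u := by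
    by_cases hP : mgOn l (γ s)
    · exact (leaf_V_le v0 l hl _ hP).trans hur
    · have e := leaf_sep hc v0 l hl _ _ hX hP
      rw [h.2 a ⟨le_rfl, h.1⟩ s hs, abs_sub_comm, abs_of_nonneg (by linarith [hs.1])] at e
      linarith
  have fin : ∀ q : MGPoint G, mgVDist G v0 q = 0 → mgDist G (γ s) q ≤ u := by
    intro q hq
    have := mgDist_le_V hc v0 v0 (γ s) q
    rw [SimpleGraph.dist_self, hq] at this
    push_cast at this
    linarith
  have zero : ∀ x w : MGPoint G, mgOn l x → ¬ mgOn l w → mgDist G x w = 0 →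
      mgVDist G v0 x = 0 ∧ mgVDist G v0 w = 0 := by
    intro x w hx hw h0
    rw [leaf_sep hc v0 l hl _ _ hx hw] at h0
    have := mgVDist_nonneg v0 x
    have := mgVDist_nonneg v0 w
    constructor <;> linarith
  by_cases c1 : mgOn l (γ'' b'')
  swap
  · right
    refine ⟨b'', ⟨h''.1, le_rfl⟩, fin _ (zero _ _ hX c1 ?_).2⟩
    rw [mgDist_comm]; exact g3
  by_cases c2 : mgOn l (γ'' a'')
  swap
  · right
    obtain ⟨t, ht, h0⟩ := geod_pass hc v0 l hl _ _ _ h'' c1 c2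
    exact ⟨t, ht, fin _ h0⟩
  by_cases c3 : mgOn l (γ' b')
  swap
  · right
    refine ⟨a'', ⟨le_rfl, h''.1⟩, fin _ (zero _ _ c2 c3 ?_).1⟩
    rw [mgDist_comm]; exact g2
  by_cases c4 : mgOn l (γ' a')
  swap
  · left
    obtain ⟨t, ht, h0⟩ := geod_pass hc v0 l hl _ _ _ h' c3 c4
    exact ⟨t, ht, fin _ h0⟩
  left
  refine ⟨a', ⟨le_rfl, h'.1⟩, fin _ (zero _ _ c4 hY ?_).1⟩
  rw [mgDist_comm]; exact g1

lemma side_near (hc : G.Connected) (hu : 1 ≤ u) (H : CoreData G u v0 Lf A B)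
    (a b a' b' a'' b'' : ℝ) (γ γ' γ'' : ℝ → MGPoint G)
    (h : IsMGGeodesic G a b γ) (h' : IsMGGeodesic G a' b' γ') (h'' : IsMGGeodesic G a'' b'' γ'')
    (g1 : mgDist G (γ b) (γ' a') = 0) (g2 : mgDist G (γ' b') (γ'' a'') = 0)
    (g3 : mgDist G (γ'' b'') (γ a) = 0) (s : ℝ) (hs : s ∈ Set.Icc a b) :
    (∃ t ∈ Set.Icc a' b', mgDist G (γ s) (γ' t) ≤ u) ∨
    (∃ t ∈ Set.Icc a'' b'', mgDist G (γ s) (γ'' t) ≤ u) := by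
  by_cases n1 : s - a ≤ u
  · right
    refine ⟨b'', ⟨h''.1, le_rfl⟩, ?_⟩
    rw [mgDist_congr hc _ _ _ g3, h.2 s hs a ⟨le_rfl, h.1⟩, abs_of_nonneg (by linarith [hs.1])]
    exact n1
  by_cases n2 : b - s ≤ u
  · left
    refine ⟨a', ⟨le_rfl, h'.1⟩, ?_⟩
    rw [← mgDist_congr hc _ _ _ g1, h.2 s hs b ⟨h.1, le_rfl⟩, abs_sub_comm,
      abs_of_nonneg (by linarith [hs.2])]
    exact n2
  push Not at n1 n2
  have hlong : 2 * (u : ℝ) < b - a := by linarith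
  by_cases hX : ∃ l, Lf l ∧ mgOn l (γ a)
  · obtain ⟨l, hl, hX⟩ := hX
    exact side_case hc hu H a b a' b' a'' b'' γ γ' γ'' h h' h'' g1 g2 g3 s hs n2 l hl hX hlong
  by_cases hY : ∃ l, Lf l ∧ mgOn l (γ b)
  · obtain ⟨l, hl, hY⟩ := hY
    have := side_case hc hu H (-b) (-a) (-b'') (-a'') (-b') (-a')
      (fun s => γ (-s)) (fun s => γ'' (-s)) (fun s => γ' (-s)) (geod_reverse _ _ _ h)
      (geod_reverse _ _ _ h'') (geod_reverse _ _ _ h')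
      (by simp only [neg_neg]; rw [mgDist_comm]; exact g3)
      (by simp only [neg_neg]; rw [mgDist_comm]; exact g2)
      (by simp only [neg_neg]; rw [mgDist_comm]; exact g1)
      (-s) ⟨by linarith [hs.2], by linarith [hs.1]⟩ (by linarith) l hl
      (by simp only [neg_neg]; exact hY) (by linarith)
    simp only [neg_neg] at this
    rcases this with ⟨t, ht, e⟩ | ⟨t, ht, e⟩
    · right; exact ⟨-t, ⟨by linarith [ht.2], by linarith [ht.1]⟩, e⟩
    · left; exact ⟨-t, ⟨by linarith [ht.2], by linarith [ht.1]⟩, e⟩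
  exfalso
  have := core_diam hc H (γ a) (γ b) (fun hh => hX ⟨_, hh, Or.inl rfl⟩)
    (fun hh => hX ⟨_, hh, Or.inr rfl⟩) (fun hh => hY ⟨_, hh, Or.inl rfl⟩)
    (fun hh => hY ⟨_, hh, Or.inr rfl⟩)
  rw [h.2 a ⟨le_rfl, h.1⟩ b ⟨h.1, le_rfl⟩, abs_sub_comm, abs_of_nonneg (by linarith [h.1])] at this
  linarith

lemma hypDelta_upper (hc : G.Connected) (hu : 1 ≤ u) (H : CoreData G u v0 Lf A B) :
    hypDelta G ≤ u := by
  apply Real.sSup_le _ (by positivity)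
  rintro d ⟨T, rfl⟩
  refine triangleDelta_bdd T u (by positivity) ?_ ?_ ?_
  · exact side_near hc hu H _ _ _ _ _ _ _ _ _ T.h1 T.h2 T.h3 T.glue1 T.glue2 T.glue3
  · intro s hs
    exact (side_near hc hu H _ _ _ _ _ _ _ _ _ T.h2 T.h3 T.h1 T.glue2 T.glue3 T.glue1 s hs).symm
  · exact side_near hc hu H _ _ _ _ _ _ _ _ _ T.h3 T.h1 T.h2 T.glue3 T.glue1 T.glue2

end UpperBound

section Construction

/-- Vertices of the subdivided complete bipartite graph with `m` extra leaves. -/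
abbrev KV (u m : ℕ) : Type := Fin 3 ⊕ Fin 3 ⊕ (Fin 3 × Fin 3 × Fin (u - 1)) ⊕ Fin m

/-- The `k`-th vertex of the path from the `i`-th left vertex to the `j`-th right vertex. -/
def kpt (u m : ℕ) (i j : Fin 3) (k : ℕ) : KV u m :=
  if h0 : k = 0 then Sum.inl i
  else if h : k < u then Sum.inr (Sum.inr (Sum.inl (i, j, ⟨k - 1, by omega⟩)))
  else Sum.inr (Sum.inl j)

/-- A leaf. -/
def kleaf (u m : ℕ) (l : Fin m) : KV u m := Sum.inr (Sum.inr (Sum.inr l))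

/-- The graph formed by the paths `(i, j)` with `S i j`, and the leaves. -/
def Gr (u m : ℕ) (S : Fin 3 → Fin 3 → Prop) : SimpleGraph (KV u m) :=
  SimpleGraph.fromRel (fun x y =>
    (∃ i j k, k < u ∧ S i j ∧ x = kpt u m i j k ∧ y = kpt u m i j (k + 1)) ∨
    (∃ l, x = Sum.inl 0 ∧ y = kleaf u m l))

variable {u m : ℕ}

lemma kpt_zero (i j : Fin 3) : kpt u m i j 0 = Sum.inl i := by simp [kpt]

lemma kpt_last (hu : 1 ≤ u) (i j : Fin 3) : kpt u m i j u = Sum.inr (Sum.inl j) := by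
  have : u ≠ 0 := by omega
  simp [kpt, this]

lemma kpt_inj (hu : 1 ≤ u) {i j i' j' : Fin 3} {k k' : ℕ} (hk : k ≤ u) (hk' : k' ≤ u)
    (h : kpt u m i j k = kpt u m i' j' k') :
    k = k' ∧ (k < u → i = i') ∧ (0 < k → j = j') := by
  unfold kpt at h
  split_ifs at h <;> simp_all <;> omega

lemma kpt_ne_leaf (i j : Fin 3) (k : ℕ) (l : Fin m) : kpt u m i j k ≠ kleaf u m l := by
  unfold kpt kleaf
  split_ifs <;> simp

lemma kedge_inj (hu : 1 ≤ u) {i j i' j' : Fin 3} {k k' : ℕ} (hk : k < u) (hk' : k' < u)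
    (h : s(kpt u m i j k, kpt u m i j (k + 1)) = s(kpt u m i' j' k', kpt u m i' j' (k' + 1))) :
    i = i' ∧ j = j' ∧ k = k' := by
  rcases Sym2.eq_iff.1 h with ⟨h1, h2⟩ | ⟨h1, h2⟩
  · have a1 := kpt_inj hu hk.le hk'.le h1
    have a2 := kpt_inj hu hk hk' h2
    exact ⟨a1.2.1 hk, a2.2.2 (by omega), a1.1⟩
  · have a1 := kpt_inj hu hk.le hk' h1
    have a2 := kpt_inj hu hk hk'.le h2
    omega

variable {S : Fin 3 → Fin 3 → Prop}

lemma Gr_adj_cases {x y : KV u m} (h : (Gr u m S).Adj x y) :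
    (∃ i j k, k < u ∧ S i j ∧ s(x, y) = s(kpt u m i j k, kpt u m i j (k + 1))) ∨
    (∃ l, s(x, y) = s(Sum.inl 0, kleaf u m l)) := by
  rw [Gr, SimpleGraph.fromRel_adj] at h
  rcases h with ⟨_, (⟨i, j, k, h1, h2, rfl, rfl⟩ | ⟨l, rfl, rfl⟩) |
    (⟨i, j, k, h1, h2, rfl, rfl⟩ | ⟨l, rfl, rfl⟩)⟩
  · exact Or.inl ⟨i, j, k, h1, h2, rfl⟩
  · exact Or.inr ⟨l, rfl⟩
  · exact Or.inl ⟨i, j, k, h1, h2, Sym2.eq_swap⟩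
  · exact Or.inr ⟨l, Sym2.eq_swap⟩

lemma Gr_adj_path (hu : 1 ≤ u) {i j : Fin 3} {k : ℕ} (hk : k < u) (hS : S i j) :
    (Gr u m S).Adj (kpt u m i j k) (kpt u m i j (k + 1)) := by
  rw [Gr, SimpleGraph.fromRel_adj]
  refine ⟨fun h => ?_, Or.inl (Or.inl ⟨i, j, k, hk, hS, rfl, rfl⟩)⟩
  have := kpt_inj hu hk.le hk h
  omega

lemma Gr_adj_leaf (l : Fin m) : (Gr u m S).Adj (Sum.inl 0) (kleaf u m l) := by
  rw [Gr, SimpleGraph.fromRel_adj]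
  exact ⟨by simp [kleaf], Or.inl (Or.inr ⟨l, rfl, rfl⟩)⟩

lemma Gr_leaf (l : Fin m) (x : KV u m) (h : (Gr u m S).Adj (kleaf u m l) x) : x = Sum.inl 0 := by
  rcases Gr_adj_cases h with ⟨i, j, k, _, _, h1⟩ | ⟨l', h1⟩
  · rcases Sym2.eq_iff.1 h1 with ⟨h1, h2⟩ | ⟨h1, h2⟩
    · exact absurd h1.symm (kpt_ne_leaf _ _ _ _)
    · exact absurd h1.symm (kpt_ne_leaf _ _ _ _)
  · rcases Sym2.eq_iff.1 h1 with ⟨h1, h2⟩ | ⟨h1, h2⟩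
    · simp [kleaf] at h1
    · exact h2

lemma Gr_interior (hu : 1 ≤ u) {i j : Fin 3} {k : ℕ} (hk : k + 1 < u) (x : KV u m)
    (h : (Gr u m S).Adj (kpt u m i j (k + 1)) x) :
    x = kpt u m i j k ∨ x = kpt u m i j (k + 1 + 1) := by
  rcases Gr_adj_cases h with ⟨i', j', k', hk', _, h1⟩ | ⟨l', h1⟩
  · rcases Sym2.eq_iff.1 h1 with ⟨h1, h2⟩ | ⟨h1, h2⟩
    · obtain ⟨e1, e2, e3⟩ := kpt_inj hu hk.le hk'.le h1
      rw [← e1, ← e2 hk, ← e3 (by omega)] at h2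
      exact Or.inr h2
    · obtain ⟨e1, e2, e3⟩ := kpt_inj hu hk.le hk' h1
      have : k' = k := by omega
      rw [this, ← e2 hk, ← e3 (by omega)] at h2
      exact Or.inl h2
  · rcases Sym2.eq_iff.1 h1 with ⟨h1, h2⟩ | ⟨h1, h2⟩
    · rw [← kpt_zero (u := u) (m := m) 0 0] at h1
      have := kpt_inj hu hk.le (by omega) h1
      omega
    · exact absurd h1 (kpt_ne_leaf _ _ _ _)

lemma Gr_left (hu : 1 ≤ u) {i : Fin 3} (x : KV u m)
    (h : (Gr u m S).Adj (Sum.inl i) x) :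
    (∃ j, x = kpt u m i j 1) ∨ ∃ l, x = kleaf u m l := by
  rcases Gr_adj_cases h with ⟨i', j', k', hk', _, h1⟩ | ⟨l', h1⟩
  · rw [← kpt_zero (u := u) (m := m) i 0] at h1
    rcases Sym2.eq_iff.1 h1 with ⟨h1, h2⟩ | ⟨h1, h2⟩
    · obtain ⟨e1, e2, e3⟩ := kpt_inj hu (by omega) hk'.le h1
      rw [← e1, ← e2 hu] at h2
      exact Or.inl ⟨j', h2⟩
    · obtain ⟨e1, e2, e3⟩ := kpt_inj hu (by omega) hk' h1
      omega
  · rcases Sym2.eq_iff.1 h1 with ⟨h1, h2⟩ | ⟨h1, h2⟩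
    · exact Or.inr ⟨l', h2⟩
    · simp [kleaf] at h1

lemma Gr_right (hu : 1 ≤ u) {j : Fin 3} (x : KV u m)
    (h : (Gr u m S).Adj (Sum.inr (Sum.inl j)) x) : ∃ i, x = kpt u m i j (u - 1) := by
  rcases Gr_adj_cases h with ⟨i', j', k', hk', _, h1⟩ | ⟨l', h1⟩
  · rw [← kpt_last (u := u) (m := m) hu 0 j] at h1
    rcases Sym2.eq_iff.1 h1 with ⟨h1, h2⟩ | ⟨h1, h2⟩
    · obtain ⟨e1, e2, e3⟩ := kpt_inj hu le_rfl hk'.le h1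
      omega
    · obtain ⟨e1, e2, e3⟩ := kpt_inj hu le_rfl hk' h1
      have : k' = u - 1 := by omega
      rw [this, ← e3 hu] at h2
      exact ⟨i', h2⟩
  · rcases Sym2.eq_iff.1 h1 with ⟨h1, h2⟩ | ⟨h1, h2⟩
    · simp at h1
    · simp [kleaf] at h1

lemma nbr_two {V : Type} {G : SimpleGraph V} {a : V} {w : G.Walk a a} (hw : w.IsCycle) {v x : V}
    (h : w.toSubgraph.Adj v x) : (w.toSubgraph.neighborSet v).ncard = 2 :=
  hw.ncard_neighborSet_toSubgraph_eq_two (w.mem_verts_toSubgraph.1 h.fst_mem)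

lemma nbr_swap {V : Type} {G : SimpleGraph V} {a : V} {w : G.Walk a a} (hw : w.IsCycle) {v x y : V}
    (hv : ∀ z, G.Adj v z → z = x ∨ z = y) (h : w.toSubgraph.Adj v x) : w.toSubgraph.Adj v y := by
  by_contra hn
  have h2 := nbr_two hw h
  have : w.toSubgraph.neighborSet v ⊆ {x} := by
    intro z hz
    rcases hv z (w.toSubgraph.adj_sub hz) with rfl | rfl
    · rfl
    · exact absurd hz hn
  have := Set.ncard_le_ncard this (Set.finite_singleton x)
  rw [Set.ncard_singleton] at this
  omega

lemma count_two {V : Type} {G : SimpleGraph V} {a : V} {w : G.Walk a a} (hw : w.IsCycle) {v : V}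
    (f : Fin 3 → V) (hf : Function.Injective f) (κ : Fin 3 → ℕ)
    (hκ : ∀ j, κ j = 1 ∧ w.toSubgraph.Adj v (f j) ∨ κ j = 0 ∧ ¬ w.toSubgraph.Adj v (f j))
    (hv : ∀ z, w.toSubgraph.Adj v z → ∃ j, z = f j) :
    κ 0 + κ 1 + κ 2 = 0 ∨ κ 0 + κ 1 + κ 2 = 2 := by
  classical
  by_cases h : ∃ z, w.toSubgraph.Adj v z
  · right
    obtain ⟨z, hz⟩ := h
    have h2 := nbr_two hw hz
    have e : w.toSubgraph.neighborSet v =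
        ((Finset.univ.filter (fun j => w.toSubgraph.Adj v (f j))).image f : Finset V) := by
      ext z
      simp only [Subgraph.mem_neighborSet, Finset.coe_image, Finset.coe_filter, Finset.mem_univ,
        true_and, Set.mem_image, Set.mem_ofPred_eq]
      constructor
      · intro hz
        obtain ⟨j, rfl⟩ := hv z hz
        exact ⟨j, hz, rfl⟩
      · rintro ⟨j, hj, rfl⟩; exact hj
    rw [e, Set.ncard_coe_finset, Finset.card_image_of_injective _ hf, Finset.card_filter,
      Fin.sum_univ_three] at h2
    have hk : ∀ j, κ j = if w.toSubgraph.Adj v (f j) then 1 else 0 := by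
      intro j
      rcases hκ j with ⟨h1, h2⟩ | ⟨h1, h2⟩ <;> simp [h1, h2]
    rw [hk 0, hk 1, hk 2]; exact h2
  · left
    push Not at h
    have hk : ∀ j, κ j = 0 := by
      intro j
      rcases hκ j with ⟨h1, h2⟩ | ⟨h1, h2⟩
      · exact absurd h2 (h _)
      · exact h1
    simp [hk]

lemma Gr_cycle (hu : 1 ≤ u) {a : KV u m} (w : (Gr u m S).Walk a a) (hw : w.IsCycle) :
    ∃ κ : Fin 3 → Fin 3 → ℕ, (∀ i j, κ i j ≤ 1) ∧ (∀ i j, ¬ S i j → κ i j = 0) ∧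
      (∀ i, κ i 0 + κ i 1 + κ i 2 = 0 ∨ κ i 0 + κ i 1 + κ i 2 = 2) ∧
      (∀ j, κ 0 j + κ 1 j + κ 2 j = 0 ∨ κ 0 j + κ 1 j + κ 2 j = 2) ∧
      w.length = u * (κ 0 0 + κ 0 1 + κ 0 2 + (κ 1 0 + κ 1 1 + κ 1 2) +
        (κ 2 0 + κ 2 1 + κ 2 2)) ∧
      (∀ i j, s(kpt u m i j 0, kpt u m i j 1) ∈ w.edges → κ i j = 1) := by
  classical
  have noleaf : ∀ l x, ¬ w.toSubgraph.Adj (kleaf u m l) x := by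
    intro l x h
    have h2 := nbr_two hw h
    have : w.toSubgraph.neighborSet (kleaf u m l) ⊆ {Sum.inl 0} :=
      fun z hz => Gr_leaf l z (w.toSubgraph.adj_sub hz)
    have := Set.ncard_le_ncard this (Set.finite_singleton _)
    rw [Set.ncard_singleton] at this
    omega
  have step : ∀ i j k, k + 1 < u →
      (w.toSubgraph.Adj (kpt u m i j k) (kpt u m i j (k + 1)) ↔
        w.toSubgraph.Adj (kpt u m i j (k + 1)) (kpt u m i j (k + 1 + 1))) := by
    intro i j k hk
    constructor
    · intro h
      exact nbr_swap hw (Gr_interior hu hk) h.symm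
    · intro h
      exact (nbr_swap hw (fun z hz => (Gr_interior hu hk z hz).symm) h).symm
  have const : ∀ i j k, k < u →
      (w.toSubgraph.Adj (kpt u m i j k) (kpt u m i j (k + 1)) ↔
        w.toSubgraph.Adj (kpt u m i j 0) (kpt u m i j 1)) := by
    intro i j k
    induction k with
    | zero => intro _; exact Iff.rfl
    | succ k ih => intro hk; rw [← step i j k hk, ih (by omega)]
  let κ : Fin 3 → Fin 3 → ℕ :=
    fun i j => if w.toSubgraph.Adj (kpt u m i j 0) (kpt u m i j 1) then 1 else 0
  have hκ : ∀ i j, κ i j = if w.toSubgraph.Adj (kpt u m i j 0) (kpt u m i j 1) then 1 else 0 :=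
    fun _ _ => rfl
  refine ⟨κ, ?_, ?_, ?_, ?_, ?_, ?_⟩
  · intro i j; rw [hκ]; split_ifs <;> omega
  · intro i j hS
    rw [hκ, if_neg]
    intro h
    rcases Gr_adj_cases (w.toSubgraph.adj_sub h) with ⟨i', j', k', hk', hS', h1⟩ | ⟨l', h1⟩
    · obtain ⟨rfl, rfl, rfl⟩ := kedge_inj hu (k := 0) hu hk' h1
      exact hS hS'
    · rcases Sym2.eq_iff.1 h1 with ⟨h1, h2⟩ | ⟨h1, h2⟩
      · exact kpt_ne_leaf _ _ _ _ h2
      · exact kpt_ne_leaf _ _ _ _ h1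
  · intro i
    refine count_two hw (v := Sum.inl i) (fun j => kpt u m i j 1) ?_ (κ i) ?_ ?_
    · intro j j' h
      exact (kpt_inj hu hu hu h).2.2 (by omega)
    · intro j
      rw [hκ, kpt_zero]
      split_ifs with h <;> simp [h]
    · intro z hz
      rcases Gr_left hu z (w.toSubgraph.adj_sub hz) with h | ⟨l, rfl⟩
      · exact h
      · exact absurd hz.symm (noleaf _ _)
  · intro j
    refine count_two hw (v := Sum.inr (Sum.inl j)) (fun i => kpt u m i j (u - 1)) ?_
      (fun i => κ i j) ?_ ?_
    · intro i i' h
      exact (kpt_inj hu (by omega) (by omega) h).2.1 (by omega)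
    · intro i
      simp only [hκ, ← const i j (u - 1) (by omega)]
      rw [show u - 1 + 1 = u by omega, kpt_last hu, w.toSubgraph.adj_comm]
      split_ifs with h <;> simp [h]
    · intro z hz
      exact Gr_right hu z (w.toSubgraph.adj_sub hz)
  · have e : w.edges.toFinset =
        ((Finset.univ.filter (fun ij : Fin 3 × Fin 3 =>
          w.toSubgraph.Adj (kpt u m ij.1 ij.2 0) (kpt u m ij.1 ij.2 1))) ×ˢ Finset.range u).image
        (fun x => s(kpt u m x.1.1 x.1.2 x.2, kpt u m x.1.1 x.1.2 (x.2 + 1))) := by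
      ext e
      simp only [List.mem_toFinset, Finset.mem_image, Finset.mem_product, Finset.mem_filter,
        Finset.mem_univ, true_and, Finset.mem_range]
      rw [← w.mem_edges_toSubgraph]
      constructor
      · induction e using Sym2.ind with
        | _ x y =>
        intro h
        rw [Subgraph.mem_edgeSet] at h
        rcases Gr_adj_cases (w.toSubgraph.adj_sub h) with ⟨i, j, k, hk, hS', h1⟩ | ⟨l', h1⟩
        · refine ⟨((i, j), k), ⟨?_, hk⟩, h1.symm⟩
          rw [← const i j k hk, ← Subgraph.mem_edgeSet, ← h1, Subgraph.mem_edgeSet]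
          exact h
        · rcases Sym2.eq_iff.1 h1 with ⟨rfl, rfl⟩ | ⟨rfl, rfl⟩
          · exact absurd h.symm (noleaf _ _)
          · exact absurd h (noleaf _ _)
      · rintro ⟨⟨⟨i, j⟩, k⟩, ⟨h1, h2⟩, rfl⟩
        rw [Subgraph.mem_edgeSet]
        exact (const i j k h2).2 h1
    have hl : w.length = w.edges.toFinset.card := by
      rw [List.toFinset_card_of_nodup hw.edges_nodup, Walk.length_edges]
    rw [hl, e, Finset.card_image_of_injOn, Finset.card_product, Finset.card_range, mul_comm,
      Finset.card_filter, Fintype.sum_prod_type]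
    · simp only [Fin.sum_univ_three, hκ]
    · rintro ⟨⟨i, j⟩, k⟩ h1 ⟨⟨i', j'⟩, k'⟩ h2 h
      simp only [Finset.coe_product, Finset.coe_range, Set.mem_prod, Set.mem_Iio] at h1 h2
      obtain ⟨rfl, rfl, rfl⟩ := kedge_inj hu h1.2 h2.2 h
      rfl
  · intro i j h
    rw [← w.mem_edges_toSubgraph, Subgraph.mem_edgeSet] at h
    rw [hκ, if_pos h]

lemma Gr_cycle_bounds (hu : 1 ≤ u) {a : KV u m} (w : (Gr u m S).Walk a a) (hw : w.IsCycle) :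
    4 * u ≤ w.length ∧ w.length ≤ 6 * u := by
  obtain ⟨κ, h1, h2, h3, h4, h5, h6⟩ := Gr_cycle hu w hw
  have hL := hw.three_le_length
  set N := κ 0 0 + κ 0 1 + κ 0 2 + (κ 1 0 + κ 1 1 + κ 1 2) + (κ 2 0 + κ 2 1 + κ 2 2) with hN
  have hN0 : N ≠ 0 := by
    intro h; rw [h] at h5; omega
  have hb : 4 ≤ N ∧ N ≤ 6 := by
    have a0 := h3 0
    have a1 := h3 1
    have a2 := h3 2
    have b0 := h4 0
    have b1 := h4 1
    have b2 := h4 2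
    have := h1 0 0; have := h1 0 1; have := h1 0 2
    have := h1 1 0; have := h1 1 1; have := h1 1 2
    have := h1 2 0; have := h1 2 1; have := h1 2 2
    omega
  rw [h5]
  constructor <;> nlinarith

end Construction

section Finish

variable {u m : ℕ} {S : Fin 3 → Fin 3 → Prop}

lemma Gr_dist_walk (hu : 1 ≤ u) {i j : Fin 3} (hS : S i j) (a b : ℕ) (hab : a ≤ b) (hb : b ≤ u) :
    ∃ w : (Gr u m S).Walk (kpt u m i j a) (kpt u m i j b), w.length = b - a :=
  exists_walk_seq (Gr u m S) (kpt u m i j) a b hab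
    (fun k _ h2 => Gr_adj_path hu (by omega) hS)

lemma Gr_reach_del (hu : 1 ≤ u) {i j i' j' : Fin 3} (hS : S i j) (a b : ℕ) (hab : a ≤ b)
    (hb : b ≤ u) (hne : 1 ≤ a ∨ i ≠ i' ∨ j ≠ j') :
    ((Gr u m S).deleteEdges {s(kpt u m i' j' 0, kpt u m i' j' 1)}).Reachable
      (kpt u m i j a) (kpt u m i j b) := by
  obtain ⟨w, -⟩ := exists_walk_seq
    ((Gr u m S).deleteEdges {s(kpt u m i' j' 0, kpt u m i' j' 1)}) (kpt u m i j) a b hab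
    (fun k h1 h2 => by
      rw [SimpleGraph.deleteEdges_adj]
      refine ⟨Gr_adj_path hu (by omega) hS, fun h => ?_⟩
      obtain ⟨e1, e2, e3⟩ := kedge_inj hu (k := k) (k' := 0) (by omega) (by omega) h
      rcases hne with h | h | h
      · omega
      · exact h e1
      · exact h e2)
  exact ⟨w⟩

/-- Reachability of left and right vertices after deleting the first edge of another path. -/
lemma Gr_reach_LR (hu : 1 ≤ u) {i j : Fin 3} (i' j' : Fin 3) (hS : S i j)
    (hne : i ≠ i' ∨ j ≠ j') :
    ((Gr u m S).deleteEdges {s(kpt u m i' j' 0, kpt u m i' j' 1)}).Reachable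
      (Sum.inl i) (Sum.inr (Sum.inl j)) := by
  have := Gr_reach_del (m := m) hu hS 0 u (by omega) le_rfl (i' := i') (j' := j') (Or.inr hne)
  rwa [kpt_zero, kpt_last hu] at this

lemma Gr_reach_back (hu : 1 ≤ u) {i j : Fin 3} (hS : S i j) :
    ((Gr u m S).deleteEdges {s(kpt u m i j 0, kpt u m i j 1)}).Reachable
      (Sum.inr (Sum.inl j)) (kpt u m i j 1) := by
  have := Gr_reach_del (m := m) hu hS 1 u (by omega) le_rfl (i' := i) (j' := j) (Or.inl le_rfl)
  rw [kpt_last hu] at this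
  exact this.symm

lemma Gr_mono : Gr u m S ≤ Gr u m (fun _ _ => True) := by
  intro x y h
  rw [Gr, SimpleGraph.fromRel_adj] at h ⊢
  refine ⟨h.1, h.2.imp ?_ ?_⟩
  · rintro (⟨i, j, k, h1, h2, h3⟩ | h)
    · exact Or.inl ⟨i, j, k, h1, trivial, h3⟩
    · exact Or.inr h
  · rintro (⟨i, j, k, h1, h2, h3⟩ | h)
    · exact Or.inl ⟨i, j, k, h1, trivial, h3⟩
    · exact Or.inr h

lemma exists_cycle_four (hu : 1 ≤ u) :
    ∃ (a : KV u m) (w : (Gr u m (fun _ _ => True)).Walk a a), w.IsCycle ∧ w.length = 4 * u := by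
  let S : Fin 3 → Fin 3 → Prop := fun i j => i ≠ 2 ∧ j ≠ 2
  have hS : S 0 0 := by simp [S]
  have r1 := Gr_reach_LR (S := S) (m := m) hu (i := 0) (j := 1) 0 0 (by simp [S]) (by simp)
  have r2 := Gr_reach_LR (S := S) (m := m) hu (i := 1) (j := 1) 0 0 (by simp [S]) (by simp)
  have r3 := Gr_reach_LR (S := S) (m := m) hu (i := 1) (j := 0) 0 0 (by simp [S]) (by simp)
  have r4 := Gr_reach_back (S := S) (m := m) hu hS
  have r := ((r1.trans r2.symm).trans r3).trans r4
  rw [← kpt_zero (u := u) (m := m) 0 0] at r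
  obtain ⟨a, w, hw, he⟩ := SimpleGraph.adj_and_reachable_delete_edges_iff_exists_cycle.1
    ⟨Gr_adj_path hu (k := 0) (by omega) hS, r⟩
  refine ⟨a, w.mapLe Gr_mono, hw.mapLe Gr_mono, ?_⟩
  obtain ⟨κ, h1, h2, h3, h4, h5, h6⟩ := Gr_cycle hu w hw
  have hk := h6 0 0 he
  have z1 := h2 0 2 (by simp [S])
  have z2 := h2 1 2 (by simp [S])
  have z3 := h2 2 0 (by simp [S])
  have z4 := h2 2 1 (by simp [S])
  have z5 := h2 2 2 (by simp [S])
  have a0 := h3 0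
  have a1 := h3 1
  have b0 := h4 0
  have b1 := h4 1
  have : κ 0 0 + κ 0 1 + κ 0 2 + (κ 1 0 + κ 1 1 + κ 1 2) + (κ 2 0 + κ 2 1 + κ 2 2) = 4 := by
    omega
  rw [this] at h5
  rw [SimpleGraph.Walk.length_mapLe, h5, mul_comm]

lemma exists_cycle_six (hu : 1 ≤ u) :
    ∃ (a : KV u m) (w : (Gr u m (fun _ _ => True)).Walk a a), w.IsCycle ∧ w.length = 6 * u := by
  let S : Fin 3 → Fin 3 → Prop := fun i j => i ≠ j
  have hS : S 0 1 := by simp [S]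
  have r1 := Gr_reach_LR (S := S) (m := m) hu (i := 0) (j := 2) 0 1 (by simp [S]) (by simp)
  have r2 := Gr_reach_LR (S := S) (m := m) hu (i := 1) (j := 2) 0 1 (by simp [S]) (by simp)
  have r3 := Gr_reach_LR (S := S) (m := m) hu (i := 1) (j := 0) 0 1 (by simp [S]) (by simp)
  have r4 := Gr_reach_LR (S := S) (m := m) hu (i := 2) (j := 0) 0 1 (by simp [S]) (by simp)
  have r5 := Gr_reach_LR (S := S) (m := m) hu (i := 2) (j := 1) 0 1 (by simp [S]) (by simp)
  have r6 := Gr_reach_back (S := S) (m := m) hu hS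
  have r := ((((r1.trans r2.symm).trans r3).trans r4.symm).trans r5).trans r6
  rw [← kpt_zero (u := u) (m := m) 0 1] at r
  obtain ⟨a, w, hw, he⟩ := SimpleGraph.adj_and_reachable_delete_edges_iff_exists_cycle.1
    ⟨Gr_adj_path hu (k := 0) (by omega) hS, r⟩
  refine ⟨a, w.mapLe Gr_mono, hw.mapLe Gr_mono, ?_⟩
  obtain ⟨κ, h1, h2, h3, h4, h5, h6⟩ := Gr_cycle hu w hw
  have hk := h6 0 1 he
  have z1 := h2 0 0 (by simp [S])
  have z2 := h2 1 1 (by simp [S])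
  have z3 := h2 2 2 (by simp [S])
  have a0 := h3 0
  have a1 := h3 1
  have a2 := h3 2
  have b0 := h4 0
  have b1 := h4 1
  have b2 := h4 2
  have : κ 0 0 + κ 0 1 + κ 0 2 + (κ 1 0 + κ 1 1 + κ 1 2) + (κ 2 0 + κ 2 1 + κ 2 2) = 6 := by
    omega
  rw [this] at h5
  rw [SimpleGraph.Walk.length_mapLe, h5, mul_comm]

lemma Gr_reach_kpt (hu : 1 ≤ u) (i j : Fin 3) (k : ℕ) (hk : k ≤ u) :
    (Gr u m (fun _ _ => True)).Reachable (Sum.inl i) (kpt u m i j k) := by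
  obtain ⟨w, -⟩ := Gr_dist_walk (m := m) (S := fun _ _ => True) hu (i := i) (j := j) trivial 0 k
    (by omega) hk
  rw [kpt_zero] at w
  exact ⟨w⟩

lemma Gr_connected (hu : 1 ≤ u) : (Gr u m (fun _ _ => True)).Connected := by
  have hR : ∀ i j, (Gr u m (fun _ _ => True)).Reachable (Sum.inl i) (Sum.inr (Sum.inl j)) := by
    intro i j
    have := Gr_reach_kpt (m := m) hu i j u le_rfl
    rwa [kpt_last hu] at this
  have hL : ∀ i, (Gr u m (fun _ _ => True)).Reachable (Sum.inl 0) (Sum.inl i) :=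
    fun i => (hR 0 0).trans (hR i 0).symm
  have h0 : ∀ x, (Gr u m (fun _ _ => True)).Reachable (Sum.inl 0) x := by
    rintro (i | j | ⟨i, j, k⟩ | l)
    · exact hL i
    · exact hR 0 j
    · have := Gr_reach_kpt (m := m) hu i j (k.1 + 1) (by omega)
      have e : kpt u m i j (k.1 + 1) = Sum.inr (Sum.inr (Sum.inl (i, j, k))) := by
        have : k.1 + 1 < u := by omega
        simp [kpt, this]
      rw [e] at this
      exact (hL i).trans this
    · exact (Gr_adj_leaf (S := fun _ _ => True) l).reachable
  haveI : Nonempty (KV u m) := ⟨Sum.inl 0⟩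
  exact ⟨fun x y => (h0 x).symm.trans (h0 y)⟩

lemma Gr_coreData (hu : 1 ≤ u) : CoreData (Gr u m (fun _ _ => True)) u (Sum.inl 0)
    (fun x => ∃ l, x = kleaf u m l) (fun i => Sum.inl i) (fun j => Sum.inr (Sum.inl j)) := by
  have hd : ∀ i j k, k ≤ u →
      (Gr u m (fun _ _ => True)).dist (Sum.inl i) (kpt u m i j k) ≤ k := by
    intro i j k hk
    obtain ⟨w, hw⟩ := Gr_dist_walk (m := m) (S := fun _ _ => True) hu (i := i) (j := j) trivial 0 k
      (by omega) hk
    have := SimpleGraph.dist_le w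
    rw [hw, kpt_zero] at this
    omega
  have hd' : ∀ i j k, k ≤ u →
      (Gr u m (fun _ _ => True)).dist (Sum.inr (Sum.inl j)) (kpt u m i j k) ≤ u - k := by
    intro i j k hk
    obtain ⟨w, hw⟩ := Gr_dist_walk (m := m) (S := fun _ _ => True) hu (i := i) (j := j) trivial k u
      hk le_rfl
    have := SimpleGraph.dist_le w
    rw [hw, kpt_last hu, SimpleGraph.dist_comm] at this
    exact this
  have hAB : ∀ i j, (Gr u m (fun _ _ => True)).dist (Sum.inl i) (Sum.inr (Sum.inl j)) ≤ u := by
    intro i j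
    have := hd i j u le_rfl
    rwa [kpt_last hu] at this
  refine ⟨?_, fun j => hAB 0 j, hAB, ?_⟩
  · rintro _ x ⟨l, rfl⟩ h
    exact Gr_leaf l x h
  · intro x y h hx hy
    rcases Gr_adj_cases h with ⟨i, j, k, hk, -, h1⟩ | ⟨l, h1⟩
    · rcases Sym2.eq_iff.1 h1 with ⟨rfl, rfl⟩ | ⟨rfl, rfl⟩
      · exact ⟨i, j, k, u - (k + 1), Or.inl ⟨hd i j k hk.le, hd' i j (k + 1) hk, by omega⟩⟩
      · exact ⟨i, j, k, u - (k + 1), Or.inr ⟨hd i j k hk.le, hd' i j (k + 1) hk, by omega⟩⟩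
    · rcases Sym2.eq_iff.1 h1 with ⟨rfl, rfl⟩ | ⟨rfl, rfl⟩
      · exact absurd ⟨l, rfl⟩ hy
      · exact absurd ⟨l, rfl⟩ hx

lemma Gr_girth (hu : 1 ≤ u) : (Gr u m (fun _ _ => True)).girth = 4 * u := by
  obtain ⟨a, w, hw, hl⟩ := exists_cycle_four (m := m) hu
  apply le_antisymm
  · rw [← hl]; exact hw.girth_le_length
  · have : ¬ (Gr u m (fun _ _ => True)).IsAcyclic := fun h => h w hw
    obtain ⟨b, w', hw', h'⟩ := SimpleGraph.exists_girth_eq_length.2 this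
    rw [h']
    exact (Gr_cycle_bounds hu w' hw').1

lemma Gr_circumference (hu : 1 ≤ u) : circumference (Gr u m (fun _ _ => True)) = 6 * u := by
  apply IsGreatest.csSup_eq
  refine ⟨exists_cycle_six hu, ?_⟩
  rintro _ ⟨a, w, hw, rfl⟩
  exact (Gr_cycle_bounds hu w hw).2

lemma iso_circumference {V W : Type} {G : SimpleGraph V} {H : SimpleGraph W} (f : G ≃g H) :
    circumference H = circumference G := by
  unfold circumference
  congr 1
  ext k
  constructor
  · rintro ⟨a, w, hw, rfl⟩
    exact ⟨_, w.map f.symm.toHom, hw.map f.symm.injective, by simp⟩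
  · rintro ⟨a, w, hw, rfl⟩
    exact ⟨_, w.map f.toHom, hw.map f.injective, by simp⟩

lemma iso_dist_le {V W : Type} {G : SimpleGraph V} {H : SimpleGraph W} (f : G ≃g H)
    (hc : G.Connected) (x y : V) : H.dist (f x) (f y) ≤ G.dist x y := by
  obtain ⟨w, hw⟩ := hc.exists_walk_length_eq_dist x y
  rw [← hw]
  have := SimpleGraph.dist_le (w.map f.toHom)
  rw [SimpleGraph.Walk.length_map] at this
  exact this

lemma CoreData.of_iso {V W : Type} [Fintype V] [DecidableEq V] [Fintype W] [DecidableEq W]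
    {G : SimpleGraph V} {H : SimpleGraph W}
    (f : G ≃g H) (hc : G.Connected) {v0 : V} {Lf : V → Prop} {A B : Fin 3 → V}
    (D : CoreData G u v0 Lf A B) :
    CoreData H u (f v0) (fun x => Lf (f.symm x)) (fun i => f (A i)) (fun j => f (B j)) := by
  have key := iso_dist_le f hc
  refine ⟨?_, fun j => (key _ _).trans (D.v0B j), fun i j => (key _ _).trans (D.AB i j), ?_⟩
  · intro l x hl h
    have := D.leaf _ (f.symm x) hl (f.symm.map_adj_iff.2 h)
    rw [← this]; simp
  · intro x y h hx hy
    obtain ⟨i, j, k, k', hk⟩ := D.core _ _ (f.symm.map_adj_iff.2 h) hx hy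
    have key' : ∀ a z, H.dist (f a) z ≤ G.dist a (f.symm z) := by
      intro a z
      have := key a (f.symm z)
      rwa [f.apply_symm_apply] at this
    refine ⟨i, j, k, k', hk.imp ?_ ?_⟩
    · rintro ⟨h1, h2, h3⟩
      exact ⟨(key' _ _).trans h1, (key' _ _).trans h2, h3⟩
    · rintro ⟨h1, h2, h3⟩
      exact ⟨(key' _ _).trans h1, (key' _ _).trans h2, h3⟩

lemma exists_extremal (u n : ℕ) (hu : 1 ≤ u) (hn : 9 * u - 3 ≤ n) :
    ∃ G : SimpleGraph (Fin n), memGclass (4 * u) (6 * u) G ∧ hypDelta G ≤ u := by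
  have hcard : Fintype.card (KV u (n - (9 * u - 3))) = n := by
    simp only [KV, Fintype.card_sum, Fintype.card_prod, Fintype.card_fin]
    omega
  let e := Fintype.equivFinOfCardEq hcard
  let G := Gr u (n - (9 * u - 3)) (fun _ _ => True)
  let f : G ≃g G.map e.toEmbedding := SimpleGraph.Iso.map e G
  have hc : G.Connected := Gr_connected hu
  have hc' : (G.map e.toEmbedding).Connected := f.connected_iff.1 hc
  refine ⟨G.map e.toEmbedding, ⟨hc', ?_, ?_⟩, ?_⟩
  · rw [← f.girth_eq]; exact Gr_girth hu
  · rw [iso_circumference f]; exact Gr_circumference hu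
  · exact hypDelta_upper hc' hu (CoreData.of_iso f hc (Gr_coreData hu))

end Finish

/-- Proposition (Xx): For any positive integer `u` and any `n ≥ 9u - 3`,
`A(4u, 6u, n) = u` (the lower bound `g/4` is attained). -/
theorem Agcn_attained (u n : ℕ) (hu : 1 ≤ u) (hn : 9 * u - 3 ≤ n) :
    Agcn (4 * u) (6 * u) n = (u : ℝ) := by
  obtain ⟨G, hG, hle⟩ := exists_extremal u n hu hn
  apply IsLeast.csInf_eq
  refine ⟨⟨G, hG, le_antisymm (hypDelta_lower hG.1 u hu hG.2.1) hle⟩, ?_⟩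
  rintro d ⟨H, hH, rfl⟩
  exact hypDelta_lower hH.1 u hu hH.2.1
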